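/- arXiv:2102.04519 — 12 statements merged into one kernel-verified Lean document; each statement's English description precedes it below -/
import Mathlib

section
/- Let N : Fin n → Finset (Fin m) be the neighborhood map of a bipartite graph with parts Fin n (people) and Fin m (tests) in which every left vertex has degree exactly k (|N(p)| = k for all p), and suppose the graph is an (α, β)-expander for reals α, β > 0. Then every set Q ⊆ Fin n with |Q| ≤ α·n satisfies (|N_u(Q)| : ℝ) ≥ 2β·|Q| − k·|Q|, where N_u(Q) is the set of unique neighbors of Q. -/
open Finset

/-- For an `(α, β)`-expander with left degree `k`, every `Q` with
`|Q| ≤ α·n` has at least `2β·|Q| − k·|Q|` unique neighbors. -/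
theorem unique_neighbor_lower_bound
    (n m k : ℕ) (N : Fin n → Finset (Fin m)) (α β : ℝ)
    (hα : 0 < α) (hβ : 0 < β)
    (hdeg : ∀ p : Fin n, (N p).card = k)
    (hexp : ∀ S : Finset (Fin n), (S.card : ℝ) ≤ α * n →
      β * S.card ≤ ((S.biUnion N).card : ℝ))
    (Q : Finset (Fin n)) (hQ : (Q.card : ℝ) ≤ α * n) :
    ((Finset.univ.filter (fun t : Fin m =>
        (Q.filter (fun p => t ∈ N p)).card = 1)).card : ℝ)
      ≥ 2 * β * Q.card - k * Q.card := by
  have h1 : ∑ t : Fin m, (Q.filter (fun p => t ∈ N p)).card = k * Q.card := by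
    simp only [Finset.card_filter]
    rw [Finset.sum_comm]
    have : ∀ p ∈ Q, (∑ t : Fin m, if t ∈ N p then 1 else 0) = k := by
      intro p _
      rw [← Finset.card_filter, Finset.filter_mem_eq_inter, Finset.univ_inter, hdeg p]
    rw [Finset.sum_congr rfl this, Finset.sum_const, smul_eq_mul, mul_comm]
  have h2 : (Q.biUnion N).card = ∑ t : Fin m, if t ∈ Q.biUnion N then 1 else 0 := by
    rw [← Finset.card_filter, Finset.filter_mem_eq_inter, Finset.univ_inter]
  have h3 : 2 * (Q.biUnion N).card ≤ k * Q.card + (Finset.univ.filter (fun t : Fin m =>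
        (Q.filter (fun p => t ∈ N p)).card = 1)).card := by
    rw [← h1, h2, Finset.card_filter (fun t : Fin m =>
        (Q.filter (fun p => t ∈ N p)).card = 1), ← Finset.sum_add_distrib, Finset.mul_sum]
    refine Finset.sum_le_sum fun t _ => ?_
    by_cases ht : t ∈ Q.biUnion N
    · obtain ⟨p, hp, hpt⟩ := Finset.mem_biUnion.1 ht
      have hpos : 0 < (Q.filter (fun p => t ∈ N p)).card :=
        Finset.card_pos.2 ⟨p, Finset.mem_filter.2 ⟨hp, hpt⟩⟩
      rw [if_pos ht]
      split_ifs <;> omega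
    · rw [if_neg ht]
      omega
  have h4 : (2 : ℝ) * ((Q.biUnion N).card : ℝ) ≤ k * Q.card + ((Finset.univ.filter (fun t : Fin m =>
        (Q.filter (fun p => t ∈ N p)).card = 1)).card : ℝ) := by exact_mod_cast h3
  have h5 := hexp Q hQ
  linarith
end

section
/- Let N : Fin n → Finset (Fin m) be an (α, β)-expander with left degree k, where β > 3k/4. Let I ⊆ Fin n and let P ⊆ Fin n satisfy P ∩ I = ∅, |P| ≥ |I| + 2, and |P ∪ I| ≤ α·n. Then |N_u(P ∪ I) \ N(I)| ≥ k, i.e., there are at least k tests that are unique neighbors of P ∪ I and are not neighbors of any element of I. -/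
open Finset

/-- For an `(α, β)`-expander with left degree `k` and `β > 3k/4`,
if `P ∩ I = ∅`, `|P| ≥ |I| + 2`, `|P ∪ I| ≤ α·n`, then there are at least `k`
unique neighbors of `P ∪ I` that are not neighbors of `I`. -/
theorem unique_neighbors_avoiding_I
    (n m k : ℕ) (N : Fin n → Finset (Fin m)) (α β : ℝ)
    (hα : 0 < α) (hβ : 0 < β)
    (hdeg : ∀ p : Fin n, (N p).card = k)
    (hexp : ∀ S : Finset (Fin n), (S.card : ℝ) ≤ α * n →
      β * S.card ≤ ((S.biUnion N).card : ℝ))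
    (hβk : β > 3 * k / 4)
    (I P : Finset (Fin n))
    (hPI : P ∩ I = ∅)
    (hcard : I.card + 2 ≤ P.card)
    (hsize : (((P ∪ I).card : ℝ)) ≤ α * n) :
    k ≤ ((Finset.univ.filter (fun t : Fin m =>
        ((P ∪ I).filter (fun p => t ∈ N p)).card = 1)) \ (I.biUnion N)).card := by
  classical
  set S := P ∪ I with hS
  set U := Finset.univ.filter (fun t : Fin m => (S.filter (fun p => t ∈ N p)).card = 1) with hU
  have hSc : S.card = P.card + I.card :=
    Finset.card_union_of_disjoint (Finset.disjoint_iff_inter_eq_empty.mpr hPI)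
  have hdc : ∑ t : Fin m, (S.filter (fun p => t ∈ N p)).card = S.card * k := by
    have h1 : ∑ t : Fin m, (S.filter (fun p => t ∈ N p)).card
        = ∑ p ∈ S, (Finset.univ.filter (fun t : Fin m => t ∈ N p)).card := by
      simp only [Finset.card_filter]
      exact Finset.sum_comm
    rw [h1, Finset.sum_congr rfl (g := fun _ => k)]
    · simp
    · intro p _
      rw [← hdeg p]
      congr 1
      ext t
      simp
  have hUc : U.card = ∑ t : Fin m, if (S.filter (fun p => t ∈ N p)).card = 1 then 1 else 0 := by
    rw [hU, Finset.card_filter]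
  have hNc : (S.biUnion N).card = ∑ t : Fin m, if t ∈ S.biUnion N then 1 else 0 := by
    rw [← Finset.card_filter]
    congr 1
    ext t
    simp
  have hkey : 2 * (S.biUnion N).card ≤ S.card * k + U.card := by
    rw [← hdc, hUc, hNc, ← Finset.sum_add_distrib, Finset.mul_sum]
    apply Finset.sum_le_sum
    intro t _
    by_cases ht : t ∈ S.biUnion N
    · have hpos : 0 < (S.filter (fun p => t ∈ N p)).card := by
        rw [Finset.mem_biUnion] at ht
        obtain ⟨p, hp, hpt⟩ := ht
        exact Finset.card_pos.mpr ⟨p, Finset.mem_filter.mpr ⟨hp, hpt⟩⟩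
      rw [if_pos ht]
      split_ifs <;> omega
    · rw [if_neg ht]
      omega
  have hIc : (I.biUnion N).card ≤ I.card * k :=
    Finset.card_biUnion_le_card_mul _ _ _ (fun p _ => (hdeg p).le)
  have hsd : U.card ≤ (U \ I.biUnion N).card + (I.biUnion N).card := by
    have := Finset.le_card_sdiff (I.biUnion N) U
    omega
  have he := hexp S hsize
  have hb : (3 * k / 4 : ℝ) * S.card ≤ β * S.card :=
    mul_le_mul_of_nonneg_right hβk.le (Nat.cast_nonneg _)
  have h3 : 3 * k * S.card ≤ 4 * (S.biUnion N).card := by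
    have : (3 * k * S.card : ℝ) ≤ 4 * (S.biUnion N).card := by linarith
    exact_mod_cast this
  rw [hSc] at h3 hkey
  have h4 : (I.card + 2) * k ≤ P.card * k := Nat.mul_le_mul_right k hcard
  nlinarith
end

section
/- Let N : Fin n → Finset (Fin m) be an (α, β)-expander with left degree k, where β > 3k/4. Suppose I ⊆ L ⊆ Fin n, |L| ≤ α·n, and N(L) ⊆ N(I) (so that the binary test outcomes produced by L are consistent with those produced by I). Then |L| < 2|I| + 2. -/
open Finset

/-- For an `(α, β)`-expander with left degree `k` and `β > 3k/4`,
if `I ⊆ L`, `|L| ≤ α·n`, and `N(L) ⊆ N(I)`, then `|L| < 2|I| + 2`. -/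
theorem consistent_list_small
    (n m k : ℕ) (N : Fin n → Finset (Fin m)) (α β : ℝ)
    (hα : 0 < α) (hβ : 0 < β)
    (hdeg : ∀ p : Fin n, (N p).card = k)
    (hexp : ∀ S : Finset (Fin n), (S.card : ℝ) ≤ α * n →
      β * S.card ≤ ((S.biUnion N).card : ℝ))
    (hβk : β > 3 * k / 4)
    (I L : Finset (Fin n))
    (hIL : I ⊆ L)
    (hLsize : ((L.card : ℝ)) ≤ α * n)
    (hconsistent : L.biUnion N ⊆ I.biUnion N) :
    L.card < 2 * I.card + 2 := by
  have h1 := hexp L hLsize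
  have h2 : (L.biUnion N).card ≤ I.card * k :=
    (card_le_card hconsistent).trans (card_biUnion_le_card_mul _ _ _ fun p _ => (hdeg p).le)
  have h3 : ((L.biUnion N).card : ℝ) ≤ I.card * k := by exact_mod_cast h2
  by_contra! hc
  have hc' : (2 * I.card + 2 : ℝ) ≤ L.card := by exact_mod_cast hc
  have h4 : β * (2 * I.card + 2 : ℝ) ≤ β * L.card := mul_le_mul_of_nonneg_left hc' hβ.le
  have h5 : (I.card : ℝ) * k ≤ I.card * (4 / 3 * β) :=
    mul_le_mul_of_nonneg_left (by linarith) (Nat.cast_nonneg _)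
  have h6 : 0 ≤ (I.card : ℝ) * β := by positivity
  nlinarith
end

section
/- Let N : Fin n → Finset (Fin m) be an (α, β)-expander with left degree k, where β > 3k/4, and suppose α·n ≥ 2d + 2. Let I ⊆ Fin n with |I| ≤ d be the set of defectives, and define the decoded list L = {p ∈ Fin n : N(p) ⊆ N(I)} of all people whose tests are all positive. Then I ⊆ L and |L| < 2d + 2. -/
open Finset

/-- For an `(α, β)`-expander with left degree `k`, `β > 3k/4`, and
`α·n ≥ 2d + 2`, testing a defective set `I` with `|I| ≤ d` and decoding
`L = {p : N(p) ⊆ N(I)}` yields `I ⊆ L` and `|L| < 2d + 2`. -/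
theorem decoding_list_correct_and_small
    (n m k d : ℕ) (N : Fin n → Finset (Fin m)) (α β : ℝ)
    (hα : 0 < α) (hβ : 0 < β)
    (hdeg : ∀ p : Fin n, (N p).card = k)
    (hexp : ∀ S : Finset (Fin n), (S.card : ℝ) ≤ α * n →
      β * S.card ≤ ((S.biUnion N).card : ℝ))
    (hβk : β > 3 * k / 4)
    (hαn : (2 * d + 2 : ℝ) ≤ α * n)
    (I : Finset (Fin n)) (hI : I.card ≤ d) :
    I ⊆ Finset.univ.filter (fun p : Fin n => N p ⊆ I.biUnion N) ∧
    (Finset.univ.filter (fun p : Fin n => N p ⊆ I.biUnion N)).card < 2 * d + 2 := by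
  refine ⟨fun p hp => ?_, ?_⟩
  · simp only [Finset.mem_filter, Finset.mem_univ, true_and]
    exact Finset.subset_biUnion_of_mem N hp
  · by_contra hlt
    obtain ⟨S, hSL, hS⟩ := Finset.exists_subset_card_eq (not_lt.mp hlt)
    have h1 := hexp S (by rw [hS]; push_cast; exact hαn)
    have h2 : S.biUnion N ⊆ I.biUnion N :=
      Finset.biUnion_subset.mpr fun p hp => (Finset.mem_filter.mp (hSL hp)).2
    have h3 : (I.biUnion N).card ≤ I.card * k :=
      Finset.card_biUnion_le_card_mul I N k fun p _ => (hdeg p).le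
    have h4 : (S.biUnion N).card ≤ d * k :=
      (Finset.card_le_card h2).trans (h3.trans (Nat.mul_le_mul_right k hI))
    have h5 : ((S.biUnion N).card : ℝ) ≤ d * k := by exact_mod_cast h4
    rw [hS] at h1
    push_cast at h1
    have hd : (0 : ℝ) ≤ d := Nat.cast_nonneg d
    have hk : (0 : ℝ) ≤ k := Nat.cast_nonneg k
    have h6 : (3 * k / 4 : ℝ) * (2 * d + 2) < β * (2 * d + 2) :=
      mul_lt_mul_of_pos_right hβk (by positivity)
    nlinarith [mul_nonneg hd hk]
end

section
/- There exists a constant c > 0 such that for all integers n ≥ 1, d ≥ 1 with 2d + 2 ≤ n, setting α = (2d+2)/n, there exist a positive integer k ≤ c·(1 + log(n/(2d+2))), a positive integer m ≤ ⌈8·e²·k·(2d+2)⌉, and a bipartite graph N : Fin n → Finset (Fin m) with left degree k that is an (α, 3k/4)-expander, i.e., every S ⊆ Fin n with |S| ≤ 2d + 2 satisfies |N(S)| ≥ (3k/4)·|S|. -/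
open Finset

/-- Averaging over one coordinate. -/
lemma expander_avg {n : ℕ} {V : Type} [Fintype V] [AddCommGroup V] (p : Fin n)
    (H : (Fin n → V) → ℝ) :
    (Fintype.card V : ℝ) * ∑ g, H g = ∑ g, ∑ c : V, H (g + (Pi.single p c : Fin n → V)) := by
  rw [Finset.sum_comm]
  have : ∀ c : V, ∑ g, H (g + (Pi.single p c : Fin n → V)) = ∑ g, H g := fun c =>
    Equiv.sum_comp (Equiv.addRight (Pi.single p c : Fin n → V)) H
  simp [this]

lemma expander_weight {n : ℕ} {V : Type} [Fintype V] [AddCommGroup V] [DecidableEq V]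
    (x : ℝ) (hx : 1 ≤ x) (s : ℕ) (S : Finset (Fin n)) (hS : S.card ≤ s) :
    ∑ g : Fin n → V, x ^ (S.card - (S.image g).card) ≤
      (Fintype.card V : ℝ) ^ n * (1 + x * s / Fintype.card V) ^ S.card := by
  have hB : (0 : ℝ) < Fintype.card V := by exact_mod_cast Fintype.card_pos
  induction S using Finset.induction_on with
  | empty => simp
  | insert p S hp ih =>
    have hc : (insert p S).card = S.card + 1 := Finset.card_insert_of_notMem hp
    have hS' : S.card ≤ s := by omega
    have ih := ih hS'
    rw [hc]
    have himg : ∀ (g : Fin n → V) (c : V), S.image (g + Pi.single p c) = S.image g := by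
      intro g c
      apply Finset.image_congr
      intro q hq
      have : q ≠ p := fun h => hp (h ▸ hq)
      simp [this]
    have key : ∀ g : Fin n → V,
        ∑ c : V, x ^ (S.card + 1 - ((insert p S).image (g + Pi.single p c)).card) ≤
          (Fintype.card V + x * s) * x ^ (S.card - (S.image g).card) := by
      intro g
      have h1 : ∀ c : V, x ^ (S.card + 1 - ((insert p S).image (g + Pi.single p c)).card) ≤
          x ^ (S.card - (S.image g).card) * (1 + if g p + c ∈ S.image g then x else 0) := by
        intro c
        rw [Finset.image_insert, himg]
        have hle : (S.image g).card ≤ S.card := Finset.card_image_le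
        have hpos : 0 ≤ x ^ (S.card - (S.image g).card) := by positivity
        by_cases h : g p + c ∈ S.image g
        · have h2 : (g + (Pi.single p c : Fin n → V)) p ∈ S.image g := by simpa using h
          rw [Finset.insert_eq_of_mem h2, if_pos h, Nat.sub_add_comm hle, pow_succ]
          nlinarith
        · have h2 : (g + (Pi.single p c : Fin n → V)) p ∉ S.image g := by simpa using h
          rw [Finset.card_insert_of_notMem h2, if_neg h, Nat.add_sub_add_right]
          simp
      refine (Finset.sum_le_sum fun c _ => h1 c).trans ?_
      rw [← Finset.mul_sum, mul_comm]
      apply mul_le_mul_of_nonneg_right _ (by positivity)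
      rw [Finset.sum_add_distrib]
      have h3 : ∑ c : V, (if g p + c ∈ S.image g then x else 0) =
          ∑ c : V, (if c ∈ S.image g then x else 0) :=
        Equiv.sum_comp (Equiv.addLeft (g p)) (fun c => if c ∈ S.image g then x else 0)
      rw [h3]
      have h4 : ((S.image g).card : ℝ) ≤ s := by
        exact_mod_cast (Finset.card_image_le).trans hS'
      simp only [Finset.sum_ite_mem, Finset.univ_inter, Finset.sum_const, nsmul_eq_mul,
        Finset.card_univ, mul_one]
      nlinarith
    have h5 := expander_avg p
      (fun g : Fin n → V => x ^ (S.card + 1 - ((insert p S).image g).card))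
    have h6 := Finset.sum_le_sum (s := (Finset.univ : Finset (Fin n → V))) fun g _ => key g
    rw [← h5, ← Finset.mul_sum] at h6
    have h7 : (Fintype.card V + x * s : ℝ) = Fintype.card V * (1 + x * s / Fintype.card V) := by
      field_simp
    rw [h7, mul_assoc] at h6
    have h8 := le_of_mul_le_mul_left h6 hB
    refine h8.trans ?_
    rw [pow_succ]
    have h9 : 0 ≤ 1 + x * s / Fintype.card V := by positivity
    calc _ ≤ (1 + x * s / Fintype.card V) * _ := mul_le_mul_of_nonneg_left ih h9
      _ = _ := by ring

/-- Number of bad functions for a fixed set. -/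
lemma expander_count {n j : ℕ} {V : Type} [Fintype V] [AddCommGroup V] [DecidableEq V]
    (S : Finset (Fin n)) (h0 : 0 < S.card) (hS : S.card ≤ Fintype.card V) :
    ((univ.filter fun f : Fin (4 * j) → Fin n → V =>
      ∑ i, (S.image (f i)).card < 3 * j * S.card).card : ℝ) ≤
    ((Fintype.card V : ℝ) ^ n) ^ (4 * j) * (16 * S.card / Fintype.card V) ^ (j * S.card) := by
  have hB : (0 : ℝ) < Fintype.card V := by exact_mod_cast Fintype.card_pos
  have hs : (0 : ℝ) < S.card := by exact_mod_cast h0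
  have hSB : (S.card : ℝ) ≤ Fintype.card V := by exact_mod_cast hS
  generalize hBdef : (Fintype.card V : ℝ) = B at *
  obtain ⟨x, hxdef⟩ : ∃ x : ℝ, x = B / S.card := ⟨_, rfl⟩
  have hx : 1 ≤ x := by
    rw [hxdef, one_le_div hs]; exact hSB
  have hx0 : 0 < x := by linarith
  have hw := expander_weight (V := V) x hx S.card S le_rfl
  have e1 : 1 + x * S.card / B = 2 := by
    rw [hxdef]; field_simp; norm_num
  rw [hBdef, e1] at hw
  have hprod : ∑ f : Fin (4 * j) → Fin n → V, ∏ i, x ^ (S.card - (S.image (f i)).card) ≤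
      (B ^ n * 2 ^ S.card) ^ (4 * j) := by
    have := Finset.prod_univ_sum (fun _ : Fin (4 * j) => (univ : Finset (Fin n → V)))
      (fun _ g => x ^ (S.card - (S.image g).card))
    rw [Fintype.piFinset_univ] at this
    rw [← this]
    simp only [Finset.prod_const, Finset.card_univ, Fintype.card_fin]
    exact pow_le_pow_left₀ (Finset.sum_nonneg fun _ _ => pow_nonneg hx0.le _) hw _
  have hlow : ((univ.filter fun f : Fin (4 * j) → Fin n → V =>
      ∑ i, (S.image (f i)).card < 3 * j * S.card).card : ℝ) * x ^ (j * S.card) ≤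
      ∑ f : Fin (4 * j) → Fin n → V, ∏ i, x ^ (S.card - (S.image (f i)).card) := by
    rw [← nsmul_eq_mul, ← Finset.sum_const]
    refine le_trans (Finset.sum_le_sum
      (g := fun f => ∏ i, x ^ (S.card - (S.image (f i)).card)) ?_) ?_
    swap
    · exact Finset.sum_le_sum_of_subset_of_nonneg (Finset.filter_subset _ _)
        (fun f _ _ => Finset.prod_nonneg fun i _ => pow_nonneg hx0.le _)
    intro f hf
    rw [Finset.mem_filter] at hf
    rw [Finset.prod_pow_eq_pow_sum]
    apply pow_le_pow_right₀ hx
    have h1 : ∑ i, (S.card - (S.image (f i)).card) + ∑ i, (S.image (f i)).card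
        = 4 * j * S.card := by
      rw [← Finset.sum_add_distrib]
      rw [Finset.sum_congr rfl fun i _ => Nat.sub_add_cancel
        (Finset.card_image_le (s := S) (f := f i))]
      simp
    have h2 := hf.2
    have h3 : 4 * j * S.card = j * S.card + 3 * j * S.card := by ring
    omega
  have hxp : 0 < x ^ (j * S.card) := pow_pos hx0 _
  have h := hlow.trans hprod
  rw [← le_div_iff₀ hxp] at h
  refine h.trans (le_of_eq ?_)
  rw [mul_pow, div_eq_mul_inv, ← inv_pow, mul_assoc]
  congr 1
  have : (16 * S.card / B : ℝ) = 2 ^ 4 * x⁻¹ := by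
    rw [hxdef, inv_div]; ring
  rw [this, mul_pow, ← pow_mul, ← pow_mul]
  congr 2
  ring

lemma expander_term {n D j s : ℕ} (hj : 1 ≤ j) (hs : 1 ≤ s) (hsD : s ≤ D)
    (h2 : 6 * (n : ℝ) / D ≤ 2 ^ j) :
    (n.choose s : ℝ) * ((s : ℝ) / (2 * D)) ^ (j * s) ≤ (1 / 2) ^ s := by
  have hs0 : (0 : ℝ) < s := by exact_mod_cast hs
  have hD0 : (0 : ℝ) < D := by exact_mod_cast (by omega : 0 < D)
  have hch : (n.choose s : ℝ) ≤ (3 * n / s) ^ s := by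
    have h1 : (n.choose s : ℝ) ≤ (n : ℝ) ^ s / s.factorial := Nat.choose_le_pow_div s n
    have h3 : (s : ℝ) ^ s / s.factorial ≤ Real.exp s :=
      Real.pow_div_factorial_le_exp s hs0.le s
    have h4 : Real.exp s ≤ 3 ^ s := by
      have := Real.exp_one_lt_d9
      rw [← mul_one (s : ℝ), Real.exp_nat_mul]
      exact pow_le_pow_left₀ (Real.exp_pos _).le (by linarith) _
    have h5 := h3.trans h4
    calc (n.choose s : ℝ) ≤ (n : ℝ) ^ s / s.factorial := h1
      _ = (n / s : ℝ) ^ s * ((s : ℝ) ^ s / s.factorial) := by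
          rw [div_pow]; field_simp
      _ ≤ (n / s : ℝ) ^ s * 3 ^ s := mul_le_mul_of_nonneg_left h5 (by positivity)
      _ = _ := by rw [← mul_pow]; congr 1; ring
  calc _ ≤ (3 * n / s : ℝ) ^ s * ((s : ℝ) / (2 * D)) ^ (j * s) :=
        mul_le_mul_of_nonneg_right hch (by positivity)
    _ = (3 * n / s * ((s : ℝ) / (2 * D)) ^ j) ^ s := by rw [pow_mul, mul_pow]
    _ ≤ (1 / 2) ^ s := by
        apply pow_le_pow_left₀ (by positivity)
        have h6 : ((s : ℝ) / (2 * D)) ^ j = (s / D : ℝ) ^ j * (1 / 2 ^ j) := by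
          rw [← one_div_pow, ← mul_pow]; congr 1; field_simp
        have h7 : (s / D : ℝ) ^ j ≤ s / D := by
          apply pow_le_of_le_one (by positivity) _ (by omega)
          rw [div_le_one hD0]; exact_mod_cast hsD
        have h8 : (1 / 2 ^ j : ℝ) * (6 * n / D) ≤ 1 := by
          rw [one_div, inv_mul_le_iff₀ (by positivity)]; linarith
        calc _ ≤ (3 * n / s : ℝ) * (s / D * (1 / 2 ^ j)) := by
              rw [h6]; gcongr
          _ = (1 / 2 ^ j : ℝ) * (6 * n / D) / 2 := by field_simp; ring
          _ ≤ _ := by linarith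

lemma expander_fun {n D j : ℕ} (hj : 1 ≤ j) (hD : 1 ≤ D)
    (h2 : 6 * (n : ℝ) / D ≤ 2 ^ j) :
    ∃ f : Fin (4 * j) → Fin n → Fin (32 * D), ∀ S : Finset (Fin n), S.card ≤ D →
      3 * j * S.card ≤ ∑ i, (S.image (f i)).card := by
  have : NeZero (32 * D) := ⟨by omega⟩
  by_contra! hcon
  have hD0 : (0 : ℝ) < D := by exact_mod_cast hD
  set P : ℝ := (((32 * D : ℕ) : ℝ) ^ n) ^ (4 * j) with hP
  have hP0 : 0 < P := by
    have : 0 < 32 * D := by omega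
    have : (0 : ℝ) < ((32 * D : ℕ) : ℝ) := by exact_mod_cast this
    positivity
  let bad : Finset (Fin n) → Finset (Fin (4 * j) → Fin n → Fin (32 * D)) := fun S =>
    univ.filter fun f => ∑ i, (S.image (f i)).card < 3 * j * S.card
  let F : ℕ → ℝ := fun s => if 1 ≤ s ∧ s ≤ D then ((s : ℝ) / (2 * D)) ^ (j * s) else 0
  let I : Finset (Finset (Fin n)) := univ.filter fun S => S.card ≤ D
  have hcover : (univ : Finset (Fin (4 * j) → Fin n → Fin (32 * D))) ⊆ I.biUnion bad := by
    intro f _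
    obtain ⟨S, hS, hb⟩ := hcon f
    simp only [Finset.mem_biUnion, I, bad, Finset.mem_filter, Finset.mem_univ, true_and]
    exact ⟨S, hS, hb⟩
  have hle : P ≤ ∑ S ∈ I, ((bad S).card : ℝ) := by
    have := (Finset.card_le_card hcover).trans Finset.card_biUnion_le
    have h3 : (Fintype.card (Fin (4 * j) → Fin n → Fin (32 * D)) : ℝ) = P := by
      simp [hP]
    rw [← h3, ← Finset.card_univ]
    exact_mod_cast this
  have hbad : ∀ S ∈ I, ((bad S).card : ℝ) ≤ P * F S.card := by
    intro S hS
    have hSD : S.card ≤ D := by simpa [I] using hS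
    rcases Nat.eq_zero_or_pos S.card with h | h
    · simp [bad, F, h]
    · have := expander_count (j := j) (V := Fin (32 * D)) S h
        (by rw [Fintype.card_fin]; omega)
      rw [Fintype.card_fin] at this
      refine this.trans (le_of_eq ?_)
      have h4 : (1 ≤ S.card ∧ S.card ≤ D) := ⟨h, hSD⟩
      simp only [F, if_pos h4, hP]
      congr 2
      push_cast
      field_simp
      norm_num
  have hF0 : ∀ s, 0 ≤ F s := by
    intro s
    simp only [F]
    split_ifs <;> positivity
  have hsum : ∑ S ∈ I, F S.card ≤ ∑ s ∈ range (n + 1), (n.choose s : ℝ) * F s := by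
    have h5 := Finset.sum_powerset_apply_card F (x := (univ : Finset (Fin n)))
    rw [Finset.card_univ, Fintype.card_fin] at h5
    simp only [nsmul_eq_mul] at h5
    rw [← h5, Finset.powerset_univ]
    exact Finset.sum_le_sum_of_subset_of_nonneg (Finset.filter_subset _ _)
      (fun S _ _ => hF0 _)
  have hgeo : ∑ s ∈ range (n + 1), (n.choose s : ℝ) * F s < 1 := by
    rw [Finset.sum_range_succ']
    have h6 : F 0 = 0 := by simp [F]
    rw [h6, mul_zero, add_zero]
    have h7 : ∀ s ∈ range n, (n.choose (s + 1) : ℝ) * F (s + 1) ≤ (1 / 2 : ℝ) ^ (s + 1) := by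
      intro s _
      by_cases h : 1 ≤ s + 1 ∧ s + 1 ≤ D
      · simp only [F, if_pos h]
        exact expander_term hj h.1 h.2 h2
      · simp only [F, if_neg h, mul_zero]
        positivity
    refine (Finset.sum_le_sum h7).trans_lt ?_
    have h8 : ∀ t : ℕ, ∑ s ∈ range t, (1 / 2 : ℝ) ^ (s + 1) = 1 - (1 / 2) ^ t := by
      intro t
      induction t with
      | zero => simp
      | succ t ih => rw [Finset.sum_range_succ, ih, pow_succ]; ring
    rw [h8]
    have : (0 : ℝ) < (1 / 2) ^ n := by positivity
    linarith
  have h9 := hle.trans (Finset.sum_le_sum hbad)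
  rw [← Finset.mul_sum] at h9
  have h10 : ∑ S ∈ I, F S.card < 1 := hsum.trans_lt hgeo
  nlinarith

/-- Existence of `((2d+2)/n, 3k/4)`-expanders with left degree
`k = O(log(n/(2d+2)))` and `m ≤ ⌈8e²k(2d+2)⌉` right vertices. -/
theorem exists_expander :
    ∃ c : ℝ, 0 < c ∧ ∀ n d : ℕ, 1 ≤ n → 1 ≤ d → 2 * d + 2 ≤ n →
      ∃ k : ℕ, 0 < k ∧
        (k : ℝ) ≤ c * (1 + Real.log ((n : ℝ) / (2 * d + 2))) ∧
        ∃ m : ℕ, 0 < m ∧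
          m ≤ ⌈8 * Real.exp 1 ^ 2 * k * (2 * d + 2)⌉₊ ∧
          ∃ N : Fin n → Finset (Fin m),
            (∀ p : Fin n, (N p).card = k) ∧
            ∀ S : Finset (Fin n), S.card ≤ 2 * d + 2 →
              (3 * (k : ℝ) / 4) * S.card ≤ ((S.biUnion N).card : ℝ) := by
  refine ⟨20, by norm_num, fun n d hn hd hnd => ?_⟩
  have hD0 : (0 : ℝ) < 2 * d + 2 := by positivity
  have hr : 1 ≤ (n : ℝ) / (2 * d + 2) := by
    rw [one_le_div hD0]; exact_mod_cast hnd
  set r : ℝ := (n : ℝ) / (2 * d + 2) with hrdef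
  have hlog : 0 ≤ Real.log r := Real.log_nonneg hr
  set L : ℝ := 1 + Real.log r with hL
  have hL1 : 1 ≤ L := by linarith
  set j : ℕ := ⌈4 * L⌉₊ with hjdef
  have hjL : 4 * L ≤ j := Nat.le_ceil _
  have hjU : (j : ℝ) < 4 * L + 1 := Nat.ceil_lt_add_one (by linarith)
  have hj : 1 ≤ j := by
    have : (1 : ℝ) ≤ j := by linarith
    exact_mod_cast this
  have h2 : 6 * (n : ℝ) / ((2 * d + 2 : ℕ) : ℝ) ≤ 2 ^ j := by
    have hl2 := Real.log_two_gt_d9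
    have e1 : Real.exp (2 + Real.log r) ≤ 2 ^ j := by
      rw [← Real.exp_log (show (0 : ℝ) < 2 by norm_num), ← Real.exp_nat_mul,
        Real.exp_log (show (0 : ℝ) < 2 by norm_num), Real.exp_le_exp]
      nlinarith
    have e2 : (6 : ℝ) ≤ Real.exp 2 := by
      have := Real.exp_one_gt_d9
      have h3 : Real.exp 2 = Real.exp 1 * Real.exp 1 := by rw [← Real.exp_add]; norm_num
      rw [h3]; nlinarith
    rw [Real.exp_add, Real.exp_log (by linarith)] at e1
    push_cast
    rw [mul_div_assoc, ← hrdef]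
    nlinarith
  obtain ⟨f, hf⟩ := expander_fun hj (by omega) h2
  refine ⟨4 * j, by omega, by push_cast; linarith, (4 * j) * (32 * (2 * d + 2)), by positivity,
    ?_, fun p => univ.image fun i => finProdFinEquiv (i, f i p), fun p => ?_, fun S hS => ?_⟩
  · have he := Real.exp_one_gt_d9
    have h3 : (32 : ℝ) ≤ 8 * Real.exp 1 ^ 2 := by nlinarith
    have h4 : (((4 * j) * (32 * (2 * d + 2)) : ℕ) : ℝ) ≤
        8 * Real.exp 1 ^ 2 * ((4 * j : ℕ) : ℝ) * (2 * d + 2) := by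
      push_cast
      calc (4 * j * (32 * (2 * d + 2)) : ℝ) = 32 * (4 * j) * (2 * d + 2) := by ring
        _ ≤ _ := by gcongr
    exact_mod_cast h4.trans (Nat.le_ceil _)
  · rw [Finset.card_image_of_injective, Finset.card_univ, Fintype.card_fin]
    intro a b hab
    have := finProdFinEquiv.injective hab
    exact (Prod.ext_iff.1 this).1
  · have h5 := hf S hS
    have h6 : ∑ i, (S.image (f i)).card ≤ (S.biUnion fun p => univ.image fun i =>
        finProdFinEquiv (i, f i p)).card := by
      rw [← Finset.card_sigma]
      apply Finset.card_le_card_of_injOn (fun q => finProdFinEquiv (q.1, q.2))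
      · rintro ⟨i, b⟩ hq
        simp only [Finset.coe_sigma, Set.mem_sigma_iff, Finset.mem_coe, Finset.mem_image] at hq
        obtain ⟨-, p, hp, rfl⟩ := hq
        simp only [Finset.mem_coe, Finset.mem_biUnion, Finset.mem_image]
        exact ⟨p, hp, i, Finset.mem_univ _, rfl⟩
      · rintro ⟨a, b⟩ - ⟨a', b'⟩ - h
        have := finProdFinEquiv.injective h
        obtain ⟨h7, h8⟩ := Prod.ext_iff.1 this
        simp only at h7 h8
        subst h7; subst h8; rfl
    have h7 := h5.trans h6
    have h8 : ((3 * j * S.card : ℕ) : ℝ) ≤ ((S.biUnion fun p => univ.image fun i =>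
        finProdFinEquiv (i, f i p)).card : ℝ) := by exact_mod_cast h7
    refine le_trans (le_of_eq ?_) h8
    push_cast
    ring
end

section
/- There exists a constant c > 0 such that for all integers n > d ≥ 1 there exist a positive integer m ≤ c·d·(1 + log(n/d)) and a binary matrix B : Fin m → Fin n → Bool such that for every set I ⊆ Fin n with |I| ≤ d, the list L(I) = {j ∈ Fin n : for every row l with B l j = true there exists i ∈ I with B l i = true} satisfies I ⊆ L(I) and |L(I)| ≤ 2d + 2. (Consequently there is a two-stage group testing scheme with O(d·log(n/d)) tests in the first round that identifies any set of at most d defectives among n people.) -/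
open Finset

lemma gt_cover {F P : Type*} [Fintype F] [DecidableEq P] (good : F → P → Prop)
    [∀ f p, Decidable (good f p)] (κ : ℝ) (S : Finset P) (hκ : κ ≤ 1)
    (hF : 0 < Fintype.card F)
    (h : ∀ p ∈ S, κ * Fintype.card F ≤ ((univ.filter (fun f => good f p)).card : ℝ)) (m : ℕ) :
    ∃ r : Fin m → F,
      ((S.filter (fun p => ∀ l, ¬ good (r l) p)).card : ℝ) ≤ (1 - κ) ^ m * S.card := by
  induction m with
  | zero => exact ⟨Fin.elim0, by simp⟩
  | succ m ih =>
    obtain ⟨r, hr⟩ := ih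
    set T := S.filter (fun p => ∀ l, ¬ good (r l) p) with hT
    have hdc : ∑ f : F, ((T.filter (fun p => good f p)).card : ℝ)
        = ∑ p ∈ T, ((univ.filter (fun f => good f p)).card : ℝ) := by
      simp only [card_filter]
      push_cast
      rw [sum_comm]
    have hge : ∑ f : F, (κ * T.card) ≤ ∑ f : F, ((T.filter (fun p => good f p)).card : ℝ) := by
      rw [hdc]
      calc ∑ f : F, (κ * T.card) = ∑ p ∈ T, (κ * Fintype.card F) := by
            simp; ring
        _ ≤ _ := sum_le_sum (fun p hp => h p (mem_filter.1 hp).1)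
    have hne : (univ : Finset F).Nonempty := by
      rw [← card_pos]; simpa using hF
    obtain ⟨f, -, hf⟩ := exists_le_of_sum_le hne hge
    refine ⟨Fin.cons f r, ?_⟩
    have hEq : S.filter (fun p => ∀ l, ¬ good ((Fin.cons f r : Fin (m+1) → F) l) p)
        = T.filter (fun p => ¬ good f p) := by
      ext p
      simp only [hT, mem_filter, Fin.forall_fin_succ, Fin.cons_zero, Fin.cons_succ]
      tauto
    rw [hEq]
    have hsum := card_filter_add_card_filter_not (s := T) (fun p => good f p)
    have hsum' : ((T.filter (fun p => good f p)).card : ℝ)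
        + ((T.filter (fun p => ¬ good f p)).card : ℝ) = T.card := by exact_mod_cast hsum
    have h1 : (1 - κ) * T.card ≤ (1 - κ) * ((1 - κ) ^ m * S.card) :=
      mul_le_mul_of_nonneg_left hr (by linarith)
    rw [pow_succ]
    nlinarith

lemma gt_avoid (n d : ℕ) (K : Finset (Fin n)) :
    ((univ.filter (fun f : Fin n → Fin (d+1) => ∀ i ∈ K, f i ≠ 0)).card : ℝ)
      = ((d : ℝ) / (d + 1)) ^ K.card * Fintype.card (Fin n → Fin (d+1)) := by
  have h1 : univ.filter (fun f : Fin n → Fin (d+1) => ∀ i ∈ K, f i ≠ 0)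
      = Fintype.piFinset (fun i => if i ∈ K then ({0}ᶜ : Finset (Fin (d+1))) else univ) := by
    ext f
    simp only [mem_filter, mem_univ, true_and, Fintype.mem_piFinset]
    refine forall_congr' fun i => ?_
    by_cases hi : i ∈ K <;> simp [hi]
  rw [h1, Fintype.card_piFinset, Fintype.card_pi]
  push_cast
  have h2 : ((d : ℝ) / (d + 1)) ^ K.card
      = ∏ i : Fin n, (if i ∈ K then (d : ℝ) / (d + 1) else 1) := by
    simp [div_pow]
  rw [h2, ← prod_mul_distrib]
  refine prod_congr rfl fun i _ => ?_
  by_cases hi : i ∈ K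
  · simp [hi, card_compl]
    field_simp
  · simp [hi]

lemma gt_good (n d : ℕ) (hd : 1 ≤ d) (I J : Finset (Fin n)) (hI : I.card = d)
    (hJ : J.card = d + 1) (hIJ : Disjoint I J) :
    (Real.exp (-1) * (1 - Real.exp (-1))) * Fintype.card (Fin n → Fin (d+1)) ≤
      ((univ.filter (fun f : Fin n → Fin (d+1) =>
        (∀ i ∈ I, f i ≠ 0) ∧ ∃ j ∈ J, f j = 0)).card : ℝ) := by
  have hs := card_filter_add_card_filter_not
    (s := univ.filter (fun f : Fin n → Fin (d+1) => ∀ i ∈ I, f i ≠ 0))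
    (fun f => ∃ j ∈ J, f j = 0)
  rw [filter_filter, filter_filter] at hs
  have he : univ.filter (fun f : Fin n → Fin (d+1) =>
      (∀ i ∈ I, f i ≠ 0) ∧ ¬ ∃ j ∈ J, f j = 0)
      = univ.filter (fun f : Fin n → Fin (d+1) => ∀ i ∈ I ∪ J, f i ≠ 0) := by
    ext f
    simp only [mem_filter, mem_univ, true_and, mem_union]
    constructor
    · rintro ⟨h1, h2⟩ i (hi | hi)
      · exact h1 i hi
      · exact fun h => h2 ⟨i, hi, h⟩
    · intro h
      exact ⟨fun i hi => h i (Or.inl hi), fun ⟨j, hj, h0⟩ => h j (Or.inr hj) h0⟩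
  rw [he] at hs
  have hs' : ((univ.filter (fun f : Fin n → Fin (d+1) =>
        (∀ i ∈ I, f i ≠ 0) ∧ ∃ j ∈ J, f j = 0)).card : ℝ) +
      ((univ.filter (fun f : Fin n → Fin (d+1) => ∀ i ∈ I ∪ J, f i ≠ 0)).card : ℝ)
      = ((univ.filter (fun f : Fin n → Fin (d+1) => ∀ i ∈ I, f i ≠ 0)).card : ℝ) := by
    exact_mod_cast hs
  rw [gt_avoid, gt_avoid, card_union_of_disjoint hIJ, hI, hJ] at hs'
  have hd0 : (0 : ℝ) < d := by exact_mod_cast hd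
  set q : ℝ := (d : ℝ) / (d + 1) with hq
  have hq1 : q ^ (d + 1) ≤ Real.exp (-1) := by
    have h : q ≤ Real.exp (-1 / (d + 1)) := by
      have := Real.add_one_le_exp (-1 / ((d : ℝ) + 1))
      have h2 : q = -1 / ((d : ℝ) + 1) + 1 := by rw [hq]; field_simp; ring
      linarith
    calc q ^ (d+1) ≤ (Real.exp (-1 / (d + 1))) ^ (d+1) := by
          apply pow_le_pow_left₀ _ h; positivity
      _ = Real.exp (-1) := by
          rw [← Real.exp_nat_mul]; congr 1; push_cast; field_simp
  have hq2 : Real.exp (-1) ≤ q ^ d := by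
    have h : Real.exp (-1 / d) ≤ q := by
      have := Real.add_one_le_exp (1 / (d : ℝ))
      have h2 : q = (1 / (d : ℝ) + 1)⁻¹ := by rw [hq]; field_simp; ring
      rw [h2, neg_div, Real.exp_neg]
      exact inv_anti₀ (by positivity) this
    calc Real.exp (-1) = (Real.exp (-1 / d)) ^ d := by
          rw [← Real.exp_nat_mul]; congr 1; field_simp
      _ ≤ q ^ d := by
          apply pow_le_pow_left₀ _ h; positivity
  have hN : (0 : ℝ) ≤ Fintype.card (Fin n → Fin (d+1)) := by positivity
  have he1 : Real.exp (-1) ≤ 1 := Real.exp_le_one_iff.2 (by norm_num)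
  have key : Real.exp (-1) * (1 - Real.exp (-1)) ≤ q ^ d * (1 - q ^ (d+1)) :=
    mul_le_mul hq2 (by linarith) (by linarith) (by positivity)
  have := mul_le_mul_of_nonneg_right key hN
  rw [pow_add] at hs'
  nlinarith

lemma gt_choose (n d k : ℕ) (hd : 1 ≤ d) (hk : d ≤ k) :
    (n.choose k : ℝ) ≤ (Real.exp 1 * (n / d)) ^ k := by
  have h1 : (n.choose k : ℝ) ≤ (n : ℝ) ^ k / (k.factorial : ℝ) := Nat.choose_le_pow_div k n
  have hd0 : (0 : ℝ) < d := by exact_mod_cast hd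
  have hk' : (d : ℝ) ≤ k := by exact_mod_cast hk
  have h2 : (k : ℝ) ^ k / k.factorial ≤ Real.exp k :=
    Real.pow_div_factorial_le_exp _ (by positivity) k
  have h3 : (d : ℝ) ^ k ≤ (k : ℝ) ^ k := pow_le_pow_left₀ hd0.le hk' k
  have hf : (0 : ℝ) < k.factorial := by exact_mod_cast k.factorial_pos
  have h4 : (d : ℝ) ^ k / k.factorial ≤ Real.exp k :=
    (div_le_div_of_nonneg_right h3 hf.le).trans h2
  calc (n.choose k : ℝ) ≤ (n : ℝ) ^ k / (k.factorial : ℝ) := h1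
    _ = ((n : ℝ) / d) ^ k * ((d : ℝ) ^ k / k.factorial) := by
        rw [div_pow]; field_simp
    _ ≤ ((n : ℝ) / d) ^ k * Real.exp k := mul_le_mul_of_nonneg_left h4 (by positivity)
    _ = _ := by
        rw [mul_pow, ← Real.exp_nat_mul, mul_one, mul_comm]

/-- There is a binary test matrix with `m = O(d·log(n/d))` rows such
that decoding by consistency yields a superset of any defective set of size at
most `d`, of size at most `2d + 2` (hence a two-stage GT scheme). -/
theorem twoStage_group_testing :
    ∃ c : ℝ, 0 < c ∧ ∀ n d : ℕ, 1 ≤ d → d < n →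
      ∃ m : ℕ, 0 < m ∧
        (m : ℝ) ≤ c * d * (1 + Real.log ((n : ℝ) / d)) ∧
        ∃ B : Fin m → Fin n → Bool,
          ∀ I : Finset (Fin n), I.card ≤ d →
            I ⊆ Finset.univ.filter
                (fun j : Fin n => ∀ l : Fin m, B l j = true → ∃ i ∈ I, B l i = true) ∧
            (Finset.univ.filter
                (fun j : Fin n => ∀ l : Fin m, B l j = true → ∃ i ∈ I, B l i = true)).card
              ≤ 2 * d + 2 := by
  have he1 : Real.exp (-1) < 1 := Real.exp_lt_one_iff.2 (by norm_num)
  have he0 : 0 < Real.exp (-1) := Real.exp_pos _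
  obtain ⟨κ, hκ⟩ : ∃ κ, κ = Real.exp (-1) * (1 - Real.exp (-1)) := ⟨_, rfl⟩
  have hκ0 : 0 < κ := by rw [hκ]; exact mul_pos he0 (by linarith)
  have hκ1 : κ ≤ 1 := by rw [hκ]; nlinarith
  refine ⟨3 / κ + 1, by positivity, fun n d hd hdn => ?_⟩
  have hd0 : (1 : ℝ) ≤ d := by exact_mod_cast hd
  have hdn' : (d : ℝ) < n := by exact_mod_cast hdn
  have hnd : 1 ≤ (n : ℝ) / d := by rw [le_div_iff₀ (by linarith)]; linarith
  obtain ⟨L, hL⟩ : ∃ L, L = 1 + Real.log ((n : ℝ) / d) := ⟨_, rfl⟩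
  have hL1 : 1 ≤ L := by rw [hL]; linarith [Real.log_nonneg hnd]
  have hexpL : Real.exp 1 * ((n : ℝ) / d) = Real.exp L := by
    rw [hL, Real.exp_add, Real.exp_log (by linarith)]
  obtain ⟨m, hm⟩ : ∃ m, m = ⌊(2 * d + 1) * L / κ⌋₊ + 1 := ⟨_, rfl⟩
  have hmlt : (2 * d + 1) * L < κ * m := by
    have := Nat.lt_floor_add_one ((2 * d + 1) * L / κ)
    rw [div_lt_iff₀ hκ0] at this
    rw [hm]; push_cast; linarith
  refine ⟨m, by omega, ?_, ?_⟩
  · have h1 : (⌊(2 * d + 1) * L / κ⌋₊ : ℝ) ≤ (2 * d + 1) * L / κ :=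
      Nat.floor_le (by positivity)
    rw [← hL, hm]
    push_cast
    have h2 : (2 * d + 1) * L / κ ≤ 3 / κ * d * L := by
      have : 3 / κ * d * L = (3 * d) * L / κ := by ring
      rw [this]
      gcongr
      linarith
    nlinarith
  · let S : Finset (Finset (Fin n) × Finset (Fin n)) :=
      ((univ.powersetCard d) ×ˢ (univ.powersetCard (d+1))).filter (fun p => Disjoint p.1 p.2)
    obtain ⟨r, hr⟩ := gt_cover (F := Fin n → Fin (d+1))
      (fun f (p : Finset (Fin n) × Finset (Fin n)) =>
        (∀ i ∈ p.1, f i ≠ 0) ∧ ∃ j ∈ p.2, f j = 0) κ S hκ1 Fintype.card_pos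
      (by
        intro p hp
        simp only [S, mem_filter, mem_product, mem_powersetCard, subset_univ, true_and] at hp
        rw [hκ]
        exact gt_good n d hd p.1 p.2 hp.1.1 hp.1.2 hp.2) m
    have hS : (S.card : ℝ) ≤ Real.exp ((2 * d + 1) * L) := by
      have h1 : S.card ≤ n.choose d * n.choose (d+1) := by
        refine (card_filter_le _ _).trans ?_
        simp [card_product, card_powersetCard]
      have h2 : (S.card : ℝ) ≤ (n.choose d : ℝ) * n.choose (d+1) := by exact_mod_cast h1
      refine h2.trans ?_
      have a := gt_choose n d d hd le_rfl
      have b := gt_choose n d (d+1) hd (by omega)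
      rw [hexpL] at a b
      calc (n.choose d : ℝ) * n.choose (d+1) ≤ Real.exp L ^ d * Real.exp L ^ (d+1) :=
            mul_le_mul a b (by positivity) (by positivity)
        _ = _ := by
          rw [← pow_add, ← Real.exp_nat_mul]; congr 1; push_cast; ring
    have hlt : (1 - κ) ^ m * S.card < 1 := by
      have h1 : (1 - κ) ^ m ≤ Real.exp (-(κ * m)) := by
        calc (1 - κ) ^ m ≤ (Real.exp (-κ)) ^ m :=
              pow_le_pow_left₀ (by linarith) (Real.one_sub_le_exp_neg κ) m
          _ = _ := by rw [← Real.exp_nat_mul]; congr 1; ring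
      calc (1 - κ) ^ m * S.card ≤ Real.exp (-(κ * m)) * Real.exp ((2 * d + 1) * L) :=
            mul_le_mul h1 hS (by positivity) (by positivity)
        _ < 1 := by
            rw [← Real.exp_add]; exact Real.exp_lt_one_iff.2 (by linarith)
    have hemp := hr.trans_lt hlt
    have hemp' : (S.filter (fun p => ∀ l, ¬ ((∀ i ∈ p.1, r l i ≠ 0) ∧ ∃ j ∈ p.2, r l j = 0))).card
        = 0 := by
      have : (S.filter (fun p => ∀ l,
        ¬ ((∀ i ∈ p.1, r l i ≠ 0) ∧ ∃ j ∈ p.2, r l j = 0))).card < 1 := by exact_mod_cast hemp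
      omega
    rw [card_eq_zero, filter_eq_empty_iff] at hemp'
    refine ⟨fun l j => decide (r l j = 0), fun I hI => ⟨?_, ?_⟩⟩
    · intro j hj
      simp only [mem_filter, mem_univ, true_and]
      exact fun l hl => ⟨j, hj, hl⟩
    · by_contra hcon
      push Not at hcon
      simp only [decide_eq_true_eq] at hcon
      set Q := univ.filter (fun j : Fin n => ∀ l : Fin m, r l j = 0 → ∃ i ∈ I, r l i = 0) with hQ
      obtain ⟨I', hII', -, hI'⟩ := exists_subsuperset_card_eq (subset_univ I) hI
        (by simpa using hdn.le)
      have hc : d + 1 ≤ (Q \ I').card := by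
        have := le_card_sdiff I' Q
        omega
      obtain ⟨J, hJ, hJc⟩ := exists_subset_card_eq hc
      have hdis : Disjoint I' J :=
        (disjoint_sdiff (s := I') (t := Q)).mono_right hJ
      refine hemp' (x := (I', J)) ?_ ?_
      · simp only [S, mem_filter, mem_product, mem_powersetCard, subset_univ, true_and]
        exact ⟨⟨hI', hJc⟩, hdis⟩
      · rintro l ⟨h1, j, hj, h0⟩
        have hjQ : j ∈ Q := (mem_sdiff.1 (hJ hj)).1
        simp only [hQ, mem_filter, mem_univ, true_and] at hjQ
        obtain ⟨i, hi, hi0⟩ := hjQ l h0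
        exact h1 i (hII' hi) hi0
end

section
/- Let γ ≥ 1, τ = (4γ)^γ, and let B : (Fin m' × Fin γ) → Fin n → ℕ be a matrix with all entries in {0,1} such that every column has exactly k ones. Let I ⊆ Fin n with |I| ≤ d. Define the binary outcome t : Fin m' × Fin γ → ℕ by t l = 1 if ∑_{j∈I} B l j ≥ 1 and t l = 0 otherwise. For each block i ∈ Fin m' define the semiquantitative outcome s¹ i = min(∑_{j∈I} ∑_{v ∈ Fin γ} (4γ)^v · B (i,v) j, τ − 1), and define the estimated binary outcome t̂ (i,v) = 1 if the v-th base-(4γ) digit of s¹ i (i.e., (s¹ i / (4γ)^v) mod 4γ) is nonzero, and t̂ (i,v) = 0 otherwise. Then the Hamming distance between t̂ and t satisfies 4 · |{l : t̂ l ≠ t l}| ≤ d·k. -/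
open Finset

/-- Base-`q` digit sums are bounded and have the expected digits. -/
theorem digit_sum_aux (q : ℕ) : ∀ (g : ℕ) (c : Fin g → ℕ), (∀ v, c v < q) →
    (∑ v : Fin g, q ^ (v : ℕ) * c v) < q ^ g ∧
    ∀ w : Fin g, ((∑ v : Fin g, q ^ (v : ℕ) * c v) / q ^ (w : ℕ)) % q = c w := by
  intro g
  induction g with
  | zero =>
    intro c _
    exact ⟨by simp, fun w => w.elim0⟩
  | succ g ih =>
    intro c hc
    obtain ⟨h1, h2⟩ := ih (fun v => c v.succ) (fun v => hc _)
    have hS : (∑ v : Fin (g + 1), q ^ (v : ℕ) * c v)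
        = c 0 + q * ∑ v : Fin g, q ^ (v : ℕ) * c v.succ := by
      rw [Fin.sum_univ_succ, Finset.mul_sum]
      simp [pow_succ, mul_comm, mul_left_comm]
    have h0 := hc 0
    have hq : 0 < q := by omega
    rw [hS]
    constructor
    · rw [pow_succ]
      nlinarith
    · intro w
      refine Fin.cases ?_ (fun w => ?_) w
      · simp [Nat.add_mul_mod_self_left, Nat.mod_eq_of_lt h0]
      · rw [Fin.val_succ, pow_succ', ← Nat.div_div_eq_div_mul, Nat.add_mul_div_left _ _ hq,
          Nat.div_eq_of_lt h0, zero_add]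
        exact h2 w

/-- Claim 5: the estimated binary outcome `t̂`, decoded digitwise
from the saturated base-`4γ` weighted outcomes `s¹`, is within Hamming distance
`dk/4` of the true binary outcome `t`. -/
theorem hamming_bound_digit_decoder
    (m' n k d γ : ℕ) (hγ : 1 ≤ γ)
    (B : Fin m' × Fin γ → Fin n → ℕ)
    (hB : ∀ l j, B l j = 0 ∨ B l j = 1)
    (hcol : ∀ j, ∑ l, B l j = k)
    (I : Finset (Fin n)) (hI : I.card ≤ d)
    (t : Fin m' × Fin γ → ℕ)
    (ht : ∀ l, t l = if 1 ≤ ∑ j ∈ I, B l j then 1 else 0)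
    (s1 : Fin m' → ℕ)
    (hs1 : ∀ i : Fin m',
      s1 i = min (∑ j ∈ I, ∑ v : Fin γ, (4 * γ) ^ (v : ℕ) * B (i, v) j)
              ((4 * γ) ^ γ - 1))
    (tHat : Fin m' × Fin γ → ℕ)
    (htHat : ∀ (i : Fin m') (v : Fin γ),
      tHat (i, v) = if (s1 i / (4 * γ) ^ (v : ℕ)) % (4 * γ) ≠ 0 then 1 else 0) :
    4 * (Finset.univ.filter (fun l : Fin m' × Fin γ => tHat l ≠ t l)).card
      ≤ d * k := by
  have hblock : ∀ i : Fin m', 4 * (∑ v : Fin γ, if tHat (i, v) ≠ t (i, v) then 1 else 0)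
      ≤ ∑ v : Fin γ, ∑ j ∈ I, B (i, v) j := by
    intro i
    by_cases hc : ∀ v : Fin γ, ∑ j ∈ I, B (i, v) j < 4 * γ
    · obtain ⟨h1, h2⟩ := digit_sum_aux (4 * γ) γ (fun v => ∑ j ∈ I, B (i, v) j) hc
      have hs : s1 i = ∑ v : Fin γ, (4 * γ) ^ (v : ℕ) * ∑ j ∈ I, B (i, v) j := by
        rw [hs1, Finset.sum_comm]
        simp only [← Finset.mul_sum]
        apply min_eq_left
        exact Nat.le_sub_one_of_lt h1
      have hz : ∀ v : Fin γ, tHat (i, v) = t (i, v) := by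
        intro v
        rw [htHat, ht, hs, h2 v]
        simp only [Nat.one_le_iff_ne_zero]
      simp [hz]
    · push Not at hc
      obtain ⟨v, hv⟩ := hc
      have h1 : (∑ v : Fin γ, if tHat (i, v) ≠ t (i, v) then 1 else 0) ≤ γ := by
        calc _ ≤ ∑ v : Fin γ, 1 := Finset.sum_le_sum (fun v _ => by split_ifs <;> simp)
          _ = γ := by simp
      have h2 := Finset.single_le_sum (f := fun v : Fin γ => ∑ j ∈ I, B (i, v) j)
        (fun _ _ => Nat.zero_le _) (Finset.mem_univ v)
      omega
  rw [Finset.card_filter, Fintype.sum_prod_type, Finset.mul_sum]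
  calc _ ≤ ∑ i : Fin m', ∑ v : Fin γ, ∑ j ∈ I, B (i, v) j :=
        Finset.sum_le_sum (fun i _ => hblock i)
    _ = ∑ l : Fin m' × Fin γ, ∑ j ∈ I, B l j := by
        rw [Fintype.sum_prod_type]
    _ = ∑ j ∈ I, ∑ l, B l j := Finset.sum_comm
    _ = I.card * k := by simp [hcol]
    _ ≤ d * k := Nat.mul_le_mul_right _ hI
end

section
/- Let γ ≥ 1, τ = (4γ)^γ, and let B : (Fin m' × Fin γ) → Fin n → ℕ be a matrix with all entries in {0,1} such that every column has exactly k ones. Let I ⊆ Fin n with |I| ≤ d. Define t, s¹, and t̂ as follows: t l = 1 iff ∑_{j∈I} B l j ≥ 1 (else 0); s¹ i = min(∑_{j∈I} ∑_{v ∈ Fin γ} (4γ)^v · B (i,v) j, τ − 1); t̂ (i,v) = 1 iff (s¹ i / (4γ)^v) mod 4γ ≠ 0 (else 0). Further define s² i = min(∑_{j∈I} ∑_{v ∈ Fin γ} B (i,v) j, τ − 1) and the corrected estimate t̄ (i,v) = 1 if s² i ≥ 4γ, and t̄ (i,v) = t̂ (i,v) otherwise. Then t̄ l ≥ t l for every l,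 and 4 · |{l : t̄ l ≠ t l}| ≤ d·k. -/
open Finset

theorem digit_aux (b g : ℕ) (x : Fin g → ℕ) (hx : ∀ v, x v < b) :
    (∑ v : Fin g, b ^ (v : ℕ) * x v) < b ^ g ∧
      ∀ v : Fin g, (∑ v : Fin g, b ^ (v : ℕ) * x v) / b ^ (v : ℕ) % b = x v := by
  let f : Fin g → Fin b := fun v => ⟨x v, hx v⟩
  have h1 : ((finFunctionFinEquiv f : Fin (b ^ g)) : ℕ) = ∑ v : Fin g, b ^ (v : ℕ) * x v := by
    rw [finFunctionFinEquiv_apply]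
    exact Finset.sum_congr rfl fun v _ => mul_comm _ _
  refine ⟨h1 ▸ (finFunctionFinEquiv f).isLt, fun v => ?_⟩
  rw [← h1]
  have h2 := congrArg (fun z => ((z v : Fin b) : ℕ)) (finFunctionFinEquiv.symm_apply_apply f)
  exact h2

/-- Claim 7: after correction using the unweighted outcomes `s²`,
the estimate `t̄` dominates the true binary outcome `t` entrywise and is within
Hamming distance `dk/4` of it. -/
theorem corrected_estimate_dominates
    (m' n k d γ : ℕ) (hγ : 1 ≤ γ)
    (B : Fin m' × Fin γ → Fin n → ℕ)
    (hB : ∀ l j, B l j = 0 ∨ B l j = 1)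
    (hcol : ∀ j, ∑ l, B l j = k)
    (I : Finset (Fin n)) (hI : I.card ≤ d)
    (t : Fin m' × Fin γ → ℕ)
    (ht : ∀ l, t l = if 1 ≤ ∑ j ∈ I, B l j then 1 else 0)
    (s1 : Fin m' → ℕ)
    (hs1 : ∀ i : Fin m',
      s1 i = min (∑ j ∈ I, ∑ v : Fin γ, (4 * γ) ^ (v : ℕ) * B (i, v) j)
              ((4 * γ) ^ γ - 1))
    (tHat : Fin m' × Fin γ → ℕ)
    (htHat : ∀ (i : Fin m') (v : Fin γ),
      tHat (i, v) = if (s1 i / (4 * γ) ^ (v : ℕ)) % (4 * γ) ≠ 0 then 1 else 0)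
    (s2 : Fin m' → ℕ)
    (hs2 : ∀ i : Fin m',
      s2 i = min (∑ j ∈ I, ∑ v : Fin γ, B (i, v) j) ((4 * γ) ^ γ - 1))
    (tBar : Fin m' × Fin γ → ℕ)
    (htBar : ∀ (i : Fin m') (v : Fin γ),
      tBar (i, v) = if 4 * γ ≤ s2 i then 1 else tHat (i, v)) :
    (∀ l : Fin m' × Fin γ, t l ≤ tBar l) ∧
    4 * (Finset.univ.filter (fun l : Fin m' × Fin γ => tBar l ≠ t l)).card
      ≤ d * k := by
  have hsw1 : ∀ i, ∑ j ∈ I, ∑ v : Fin γ, (4 * γ) ^ (v : ℕ) * B (i, v) j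
      = ∑ v : Fin γ, (4 * γ) ^ (v : ℕ) * ∑ j ∈ I, B (i, v) j := by
    intro i
    rw [Finset.sum_comm]
    simp only [Finset.mul_sum]
  have hsw2 : ∀ i, ∑ j ∈ I, ∑ v : Fin γ, B (i, v) j
      = ∑ v : Fin γ, ∑ j ∈ I, B (i, v) j := fun i => Finset.sum_comm
  have hgood : ∀ i, s2 i < 4 * γ → ∀ v, tHat (i, v) = t (i, v) := by
    intro i hi v
    rw [htHat, ht, hs1, hsw1]
    rw [hs2, hsw2] at hi
    rcases Nat.eq_or_lt_of_le hγ with h | h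
    · subst h
      obtain rfl : v = 0 := Subsingleton.elim _ _
      simp
      split_ifs <;> omega
    · have h3 : (4 * γ) ^ 2 ≤ (4 * γ) ^ γ := Nat.pow_le_pow_right (by omega) h
      have h4 : 4 * γ ≤ (4 * γ) ^ γ - 1 := by
        have : 4 * γ + 1 ≤ (4 * γ) ^ 2 := by nlinarith
        omega
      have hlt : ∑ v : Fin γ, ∑ j ∈ I, B (i, v) j < 4 * γ := by
        rcases min_lt_iff.1 hi with h | h
        · exact h
        · omega
      obtain ⟨ha, hb⟩ := digit_aux (4 * γ) γ (fun v => ∑ j ∈ I, B (i, v) j) (fun v =>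
        lt_of_le_of_lt (Finset.single_le_sum (f := fun v => ∑ j ∈ I, B (i, v) j)
          (fun _ _ => Nat.zero_le _) (Finset.mem_univ v)) hlt)
      rw [min_eq_left (by omega), hb v]
      simp only [Nat.one_le_iff_ne_zero]
  have ht1 : ∀ l, t l ≤ 1 := by
    intro l
    rw [ht]
    split_ifs <;> omega
  refine ⟨?_, ?_⟩
  · rintro ⟨i, v⟩
    rw [htBar]
    split_ifs with h
    · exact ht1 _
    · rw [hgood i (by omega) v]
  · have hblock : ∀ i, 4 * ∑ v : Fin γ, (if tBar (i, v) ≠ t (i, v) then 1 else 0)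
        ≤ ∑ v : Fin γ, ∑ j ∈ I, B (i, v) j := by
      intro i
      by_cases h : 4 * γ ≤ s2 i
      · have h1 : ∑ v : Fin γ, (if tBar (i, v) ≠ t (i, v) then 1 else 0) ≤ γ := by
          calc _ ≤ ∑ v : Fin γ, 1 := Finset.sum_le_sum fun v _ => by split_ifs <;> omega
            _ = γ := by simp
        rw [hs2, hsw2] at h
        have := le_trans h (min_le_left _ _)
        omega
      · have h1 : ∑ v : Fin γ, (if tBar (i, v) ≠ t (i, v) then 1 else 0) = 0 := by
          apply Finset.sum_eq_zero
          intro v _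
          rw [htBar, if_neg h, hgood i (by omega) v]
          simp
        omega
    calc _ = ∑ i, 4 * ∑ v : Fin γ, (if tBar (i, v) ≠ t (i, v) then 1 else 0) := by
          rw [Finset.card_filter, Fintype.sum_prod_type, Finset.mul_sum]
      _ ≤ ∑ i, ∑ v : Fin γ, ∑ j ∈ I, B (i, v) j := Finset.sum_le_sum fun i _ => hblock i
      _ = ∑ l, ∑ j ∈ I, B l j := by rw [Fintype.sum_prod_type]
      _ = I.card * k := by
          rw [Finset.sum_comm]
          simp [hcol]
      _ ≤ d * k := Nat.mul_le_mul_right _ hI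
end

section
/- Let N : Fin n → Finset (Fin m) be an (α, β)-expander with left degree k, where β > 3k/4. Let I ⊆ Fin n with |I| ≤ d, and let T̄ ⊆ Fin m be a noisy positive-test set satisfying N(I) ⊆ T̄ and 4·|T̄ \ N(I)| ≤ d·k. Then for every S ⊆ Fin n with S ∩ I = ∅, |S| ≥ |I| + 2, |S ∪ I| ≤ α·n, and 2·|S| > 5d, the set S ∪ I is not consistent with T̄, i.e., N(S ∪ I) ⊄ T̄. Consequently, every list L with I ⊆ L ⊆ Fin n, |L| ≤ α·n, and N(L) ⊆ T̄ has size |L| = O(d). -/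
open Finset

/-- Lemma 8: with a noisy positive-test set `T̄ ⊇ N(I)` having at
most `dk/4` false positives, no large set disjoint from `I` can make `S ∪ I`
consistent with `T̄`; consequently any consistent list `L ⊇ I` with
`|L| ≤ α·n` has size `O(d)` (concretely `2|L| ≤ 7d + 2`). -/
theorem noisy_consistent_list_small
    (n m k d : ℕ) (N : Fin n → Finset (Fin m)) (α β : ℝ)
    (hα : 0 < α) (hβ : 0 < β)
    (hdeg : ∀ p : Fin n, (N p).card = k)
    (hexp : ∀ S : Finset (Fin n), (S.card : ℝ) ≤ α * n →
      β * S.card ≤ ((S.biUnion N).card : ℝ))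
    (hβk : β > 3 * k / 4)
    (I : Finset (Fin n)) (hI : I.card ≤ d)
    (Tbar : Finset (Fin m))
    (hT1 : I.biUnion N ⊆ Tbar)
    (hT2 : 4 * (Tbar \ I.biUnion N).card ≤ d * k) :
    (∀ S : Finset (Fin n), S ∩ I = ∅ → I.card + 2 ≤ S.card →
      (((S ∪ I).card : ℝ)) ≤ α * n → 5 * d < 2 * S.card →
      ¬ ((S ∪ I).biUnion N ⊆ Tbar)) ∧
    (∀ L : Finset (Fin n), I ⊆ L → ((L.card : ℝ)) ≤ α * n →
      L.biUnion N ⊆ Tbar → 2 * L.card ≤ 7 * d + 2) := by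
  have key : ∀ L : Finset (Fin n), ((L.card : ℝ)) ≤ α * n → 0 < L.card →
      L.biUnion N ⊆ Tbar → 3 * L.card < 4 * I.card + d := by
    intro L hL hpos hcons
    have h1 := hexp L hL
    have h2 : (L.biUnion N).card ≤ (Tbar \ I.biUnion N).card + (I.biUnion N).card := by
      rw [Finset.card_sdiff_add_card_eq_card hT1]
      exact Finset.card_le_card hcons
    have h3 : (I.biUnion N).card ≤ I.card * k :=
      Finset.card_biUnion_le_card_mul _ _ _ (fun p _ => (hdeg p).le)
    have h4 : 4 * (L.biUnion N).card ≤ k * (4 * I.card + d) := by nlinarith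
    have h5 : (4 : ℝ) * (L.biUnion N).card ≤ k * (4 * I.card + d) := by exact_mod_cast h4
    have hposR : (0 : ℝ) < L.card := by exact_mod_cast hpos
    have h6 : 3 * (k : ℝ) / 4 * L.card < β * L.card := mul_lt_mul_of_pos_right hβk hposR
    have h7 : (k : ℝ) * (3 * L.card) < k * (4 * I.card + d) := by nlinarith
    have h8 : k * (3 * L.card) < k * (4 * I.card + d) := by exact_mod_cast h7
    exact lt_of_mul_lt_mul_left h8 (Nat.zero_le k)
  refine ⟨fun S hSI hS hα' h5 hc => ?_, fun L _ hL hc => ?_⟩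
  · have hcard : (S ∪ I).card = S.card + I.card :=
      Finset.card_union_of_disjoint (Finset.disjoint_iff_inter_eq_empty.mpr hSI)
    have := key (S ∪ I) hα' (by omega) hc
    omega
  · rcases Nat.eq_zero_or_pos L.card with h | h
    · omega
    · have := key L hL h hc
      omega
end

section
/- Let q be a prime, γ ≥ 1, L ≥ 1, let I be a finite set of vectors in Fin L → ZMod q, let c ∈ Fin L, r ∈ ℕ, and let x : Fin L → ZMod q satisfy r·γ ≤ (x c).val ≤ min((r+1)·γ − 1, q − 1). Suppose (i) no z ∈ I has z c = x c, and (ii) |{z ∈ I : r·γ ≤ (z c).val ≤ min((r+1)·γ − 1, q − 1)}| ≤ 4γ − 1. Let v' = (x c).val − r·γ and let O = ∑_{z ∈ I, r·γ ≤ (z c).val ≤ min((r+1)·γ−1, q−1)} (4γ)^{(z c).val − r·γ} be the unsaturated outcome of the weighted test T_{(c,r)}. Then the v'-th base-(4γ) digit of O is zero: (O / (4γ)^{v'}) mod (4γ) = 0. (Hence the test outcomes certify that x is not defective.) -/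
open Finset

theorem digit_zero_aux {α : Type*} (S : Finset α) (e : α → ℕ) (B v : ℕ) (hB : 1 ≤ B)
    (hc : S.card ≤ B - 1) (hne : ∀ z ∈ S, e z ≠ v) :
    ((∑ z ∈ S, B ^ e z) / B ^ v) % B = 0 := by
  rw [← Finset.sum_filter_add_sum_filter_not S (fun z => e z < v)]
  have hlow : ∑ z ∈ S.filter (fun z => e z < v), B ^ e z < B ^ v := by
    rcases v with _ | w
    · simp
    · calc ∑ z ∈ S.filter (fun z => e z < w + 1), B ^ e z
          ≤ (S.filter (fun z => e z < w + 1)).card • B ^ w := by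
            apply Finset.sum_le_card_nsmul
            intro z hz
            have hz' := (Finset.mem_filter.mp hz).2
            exact Nat.pow_le_pow_right hB (by omega)
        _ ≤ (B - 1) * B ^ w := by
            rw [smul_eq_mul]
            exact Nat.mul_le_mul_right _ ((Finset.card_filter_le _ _).trans hc)
        _ < B * B ^ w := Nat.mul_lt_mul_of_pos_right (by omega) (by positivity)
        _ = B ^ (w + 1) := by ring
  have hhigh : B ^ (v + 1) ∣ ∑ z ∈ S.filter (fun z => ¬ e z < v), B ^ e z := by
    apply Finset.dvd_sum
    intro z hz
    have hz' := Finset.mem_filter.mp hz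
    have := hne z hz'.1
    exact pow_dvd_pow _ (by omega)
  obtain ⟨k, hk⟩ := hhigh
  have hpos : 0 < B ^ v := by positivity
  rw [hk, pow_succ, mul_assoc, Nat.add_mul_div_left _ _ hpos, Nat.div_eq_of_lt hlow]
  simp

/-- Claim 6: if no defective shares the `c`-th coordinate with
`x` and the test `T_{(c,r)}` contains at most `4γ − 1` defectives, then the
base-`4γ` digit of the weighted test outcome corresponding to `x`'s weight
class is zero, certifying that `x` is not defective. -/
theorem outcome_digit_zero_certificate
    (q : ℕ) (hq : q.Prime) (γ L : ℕ) (hγ : 1 ≤ γ) (hL : 1 ≤ L)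
    (I : Finset (Fin L → ZMod q)) (c : Fin L) (r : ℕ)
    (x : Fin L → ZMod q)
    (hx : r * γ ≤ (x c).val ∧ (x c).val ≤ min ((r + 1) * γ - 1) (q - 1))
    (h1 : ∀ z ∈ I, z c ≠ x c)
    (h2 : (I.filter (fun z => r * γ ≤ (z c).val ∧
        (z c).val ≤ min ((r + 1) * γ - 1) (q - 1))).card ≤ 4 * γ - 1) :
    ((∑ z ∈ I.filter (fun z => r * γ ≤ (z c).val ∧
          (z c).val ≤ min ((r + 1) * γ - 1) (q - 1)),
        (4 * γ) ^ ((z c).val - r * γ)) / (4 * γ) ^ ((x c).val - r * γ)) % (4 * γ)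
      = 0 := by
  have : NeZero q := ⟨hq.ne_zero⟩
  apply digit_zero_aux _ (fun z => (z c).val - r * γ) _ _ (by omega) h2
  intro z hz heq
  have hz' := Finset.mem_filter.mp hz
  apply h1 z hz'.1
  apply ZMod.val_injective q
  have h3 := hz'.2.1
  have h4 := hx.1
  omega
end

section
/- Let q be an odd prime, d ≥ 1, γ ≥ 1, L ≥ 1, and let C be a submodule of (Fin L → ZMod q) containing the all-ones vector 𝟏, such that any two distinct elements u, v of C agree in fewer than L/(2d) coordinates (i.e., 2d·|{c : u c = v c}| < L; equivalently C has relative minimum distance δ > 1 − 1/(2d)). Let I ⊆ C with |I| ≤ d, and let x ∈ C be such that x ≠ y + (i : ZMod q)·𝟏 for every y ∈ I and every integer i with −(γ−1) ≤ i ≤ γ−1. Then there exists a coordinate c ∈ Fin L such that (i) x c ≠ y c for every y ∈ I, and (ii) |{(y, i) ∈ I × (Finset.Icc (−(γ−1) : ℤ) (γ−1)) : y c + (i : ZMod q) = x c}| ≤ 4γ − 1. -/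
open Finset

/-- Double counting: if every `p ∈ S` is related to few coordinates, the total is small. -/
theorem double_count_aux {α : Type*} (L d : ℕ) (S : Finset α) (r : α → Fin L → Prop)
    [∀ p c, Decidable (r p c)]
    (h : ∀ p ∈ S, 2 * d * (Finset.univ.filter (fun c => r p c)).card ≤ L) :
    2 * d * ∑ c : Fin L, (S.filter (fun p => r p c)).card ≤ S.card * L := by
  have e : ∑ c : Fin L, (S.filter (fun p => r p c)).card
      = ∑ p ∈ S, (Finset.univ.filter (fun c => r p c)).card := by
    simp only [Finset.card_filter]
    exact Finset.sum_comm
  rw [e, Finset.mul_sum]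
  simpa using Finset.sum_le_card_nsmul S _ L h

/-- key step of Lemma 10: for a code of relative distance
`> 1 − 1/(2d)` containing the all-ones word, any non-shifted-defective codeword
`x` admits a coordinate `c` at which `x` disagrees with every defective and
matches at most `4γ − 1` shifted defectives. -/
theorem exists_good_coordinate
    (q : ℕ) (hq : q.Prime) (hodd : Odd q) (d γ L : ℕ)
    (hd : 1 ≤ d) (hγ : 1 ≤ γ) (hL : 1 ≤ L)
    (C : Submodule (ZMod q) (Fin L → ZMod q))
    (hone : (fun _ => (1 : ZMod q) : Fin L → ZMod q) ∈ C)
    (hdist : ∀ u ∈ C, ∀ v ∈ C, u ≠ v →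
      2 * d * (Finset.univ.filter (fun c : Fin L => u c = v c)).card < L)
    (I : Finset (Fin L → ZMod q)) (hIC : ∀ y ∈ I, y ∈ C) (hI : I.card ≤ d)
    (x : Fin L → ZMod q) (hxC : x ∈ C)
    (hx : ∀ y ∈ I, ∀ i : ℤ, -((γ : ℤ) - 1) ≤ i → i ≤ (γ : ℤ) - 1 →
      x ≠ y + (i : ZMod q) • (fun _ => (1 : ZMod q))) :
    ∃ c : Fin L,
      (∀ y ∈ I, x c ≠ y c) ∧
      ((I ×ˢ Finset.Icc (-((γ : ℤ) - 1)) ((γ : ℤ) - 1)).filter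
          (fun p => p.1 c + ((p.2 : ZMod q)) = x c)).card ≤ 4 * γ - 1 := by
  by_contra hcon
  push Not at hcon
  have hA := double_count_aux L d I (fun y c => x c = y c) (by
    intro y hy
    refine (hdist x hxC y (hIC y hy) ?_).le
    have := hx y hy 0 (by omega) (by omega)
    simpa using this)
  have hB := double_count_aux L d (I ×ˢ Finset.Icc (-((γ : ℤ) - 1)) ((γ : ℤ) - 1))
    (fun p c => p.1 c + ((p.2 : ZMod q)) = x c) (by
    rintro ⟨y, i⟩ hp
    rw [Finset.mem_product, Finset.mem_Icc] at hp
    obtain ⟨hy, hi1, hi2⟩ := hp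
    have := hdist (y + (i : ZMod q) • (fun _ => (1 : ZMod q)))
      (C.add_mem (hIC y hy) (C.smul_mem _ hone)) x hxC (hx y hy i hi1 hi2).symm
    simpa using this.le)
  have hcard : (Finset.Icc (-((γ : ℤ) - 1)) ((γ : ℤ) - 1)).card = 2 * γ - 1 := by
    rw [Int.card_Icc]; omega
  rw [Finset.card_product, hcard] at hB
  set N : Fin L → ℕ := fun c => ((I ×ˢ Finset.Icc (-((γ : ℤ) - 1)) ((γ : ℤ) - 1)).filter
          (fun p => p.1 c + ((p.2 : ZMod q)) = x c)).card with hN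
  set M : Fin L → ℕ := fun c => (I.filter (fun y => x c = y c)).card with hM
  have hA' : 2 * d * ∑ c, M c ≤ I.card * L := hA
  have hB' : 2 * d * ∑ c, N c ≤ I.card * (2 * γ - 1) * L := hB
  have hpt : ∀ c, 4 * γ ≤ 4 * γ * M c + N c := by
    intro c
    by_cases hc : ∀ y ∈ I, x c ≠ y c
    · have : 4 * γ - 1 < N c := hcon c hc
      have : 4 * γ ≤ N c := by omega
      exact this.trans (Nat.le_add_left _ _)
    · push Not at hc
      obtain ⟨y, hy, hyc⟩ := hc
      have : 0 < M c := Finset.card_pos.mpr ⟨y, by simp [hy, hyc]⟩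
      nlinarith
  have hsum : L * (4 * γ) ≤ 4 * γ * ∑ c, M c + ∑ c, N c := by
    have := Finset.sum_le_sum (s := Finset.univ) (fun c _ => hpt c)
    simpa [Finset.sum_add_distrib, Finset.mul_sum] using this
  obtain ⟨g, rfl⟩ : ∃ g, γ = g + 1 := ⟨γ - 1, by omega⟩
  have e : 2 * (g + 1) - 1 = 2 * g + 1 := by omega
  rw [e] at hB'
  have h1 : 2 * d * ∑ c, M c ≤ d * L := hA'.trans (Nat.mul_le_mul_right _ hI)
  have h2 : 2 * d * ∑ c, N c ≤ d * (2 * g + 1) * L :=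
    hB'.trans (Nat.mul_le_mul_right _ (Nat.mul_le_mul_right _ hI))
  have h3 := Nat.mul_le_mul_left (2 * d) hsum
  have h4 := Nat.mul_le_mul_left (4 * (g + 1)) h1
  have h5 : 0 < d * L := Nat.mul_pos hd hL
  have h6 : 0 ≤ d * L * g := Nat.zero_le _
  nlinarith
end

section
/- Let q be an odd prime, d ≥ 1, γ ≥ 1, L ≥ 1, and let C be a submodule of (Fin L → ZMod q) containing the all-ones vector 𝟏, such that any two distinct elements of C agree in fewer than L/(2d) coordinates. Let I ⊆ C with |I| ≤ d, and let x ∈ C be such that x ≠ y + (i : ZMod q)·𝟏 for every y ∈ I and every integer i with −(γ−1) ≤ i ≤ γ−1. Then 4·|{c ∈ Fin L : |{(y, i) ∈ I × (Finset.Icc (−(γ−1) : ℤ) (γ−1)) : y c + (i : ZMod q) = x c}| ≥ 4γ}| < L, i.e., the number of coordinates at which x agrees with at least 4γ of the shifted defective codewords is less than L/4. -/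
open Finset

/-- for a code of relative distance `> 1 − 1/(2d)` containing the
all-ones word, a non-shifted-defective codeword `x` agrees with at least `4γ`
shifted defectives in fewer than `L/4` coordinates. -/
theorem heavy_agreement_coordinates_small
    (q : ℕ) (hq : q.Prime) (hodd : Odd q) (d γ L : ℕ)
    (hd : 1 ≤ d) (hγ : 1 ≤ γ) (hL : 1 ≤ L)
    (C : Submodule (ZMod q) (Fin L → ZMod q))
    (hone : (fun _ => (1 : ZMod q) : Fin L → ZMod q) ∈ C)
    (hdist : ∀ u ∈ C, ∀ v ∈ C, u ≠ v →
      2 * d * (Finset.univ.filter (fun c : Fin L => u c = v c)).card < L)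
    (I : Finset (Fin L → ZMod q)) (hIC : ∀ y ∈ I, y ∈ C) (hI : I.card ≤ d)
    (x : Fin L → ZMod q) (hxC : x ∈ C)
    (hx : ∀ y ∈ I, ∀ i : ℤ, -((γ : ℤ) - 1) ≤ i → i ≤ (γ : ℤ) - 1 →
      x ≠ y + (i : ZMod q) • (fun _ => (1 : ZMod q))) :
    4 * (Finset.univ.filter (fun c : Fin L =>
        4 * γ ≤ ((I ×ˢ Finset.Icc (-((γ : ℤ) - 1)) ((γ : ℤ) - 1)).filter
            (fun p => p.1 c + ((p.2 : ZMod q)) = x c)).card)).card < L := by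
  set P := I ×ˢ Finset.Icc (-((γ : ℤ) - 1)) ((γ : ℤ) - 1) with hP
  set H := Finset.univ.filter (fun c : Fin L =>
        4 * γ ≤ (P.filter (fun p => p.1 c + ((p.2 : ZMod q)) = x c)).card) with hH
  have hPcard : P.card ≤ d * (2 * γ - 1) := by
    rw [hP, Finset.card_product, Int.card_Icc]
    apply Nat.mul_le_mul hI
    omega
  have h1 : H.card * (4 * γ) ≤
      ∑ p ∈ P, (Finset.univ.filter (fun c : Fin L => p.1 c + (p.2 : ZMod q) = x c)).card := by
    calc H.card * (4 * γ)
        ≤ ∑ c ∈ H, (P.filter (fun p => p.1 c + ((p.2 : ZMod q)) = x c)).card := by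
          rw [← smul_eq_mul]
          apply Finset.card_nsmul_le_sum
          intro c hc
          exact (Finset.mem_filter.mp hc).2
      _ ≤ ∑ c, (P.filter (fun p => p.1 c + ((p.2 : ZMod q)) = x c)).card :=
          Finset.sum_le_sum_of_subset (Finset.subset_univ _)
      _ = _ := by
          simp only [Finset.card_filter]
          exact Finset.sum_comm
  have h2 : ∀ p ∈ P, 2 * d *
      (Finset.univ.filter (fun c : Fin L => p.1 c + (p.2 : ZMod q) = x c)).card ≤ L := by
    intro p hp
    obtain ⟨hy, hi⟩ := Finset.mem_product.mp hp
    obtain ⟨hi1, hi2⟩ := Finset.mem_Icc.mp hi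
    have := hdist _ (C.add_mem (hIC _ hy) (C.smul_mem (p.2 : ZMod q) hone)) x hxC
      (hx _ hy _ hi1 hi2).symm
    simpa using this.le
  have h3 : 2 * d * (H.card * (4 * γ)) ≤ d * (2 * γ - 1) * L := by
    calc 2 * d * (H.card * (4 * γ)) ≤ 2 * d * _ := Nat.mul_le_mul_left _ h1
      _ = _ := Finset.mul_sum _ _ _
      _ ≤ P.card • L := Finset.sum_le_card_nsmul _ _ _ h2
      _ ≤ _ := Nat.mul_le_mul_right _ hPcard
  have h4 : H.card * (8 * γ) ≤ (2 * γ - 1) * L := by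
    apply Nat.le_of_mul_le_mul_left _ hd
    calc d * (H.card * (8 * γ)) = 2 * d * (H.card * (4 * γ)) := by ring
      _ ≤ _ := h3
      _ = _ := by ring
  have h5 : (2 * γ - 1) * L < 2 * γ * L := Nat.mul_lt_mul_of_pos_right (by omega) hL
  by_contra hcon
  push Not at hcon
  have h6 : 2 * γ * L ≤ 2 * γ * (4 * H.card) := Nat.mul_le_mul_left _ hcon
  have h7 : 2 * γ * (4 * H.card) = H.card * (8 * γ) := by ring
  omega
end
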